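/- arXiv:1706.00851 — 3 statements merged into one kernel-verified Lean document; each statement's English description precedes it below -/
import Mathlib

section
/- Let d ≥ 2 and let G be a finite simple d-regular graph. For every k ≥ 3, M_k = N_k + Σ_{r=1}^{⌊k/2⌋} (d−2)(d−1)^{r−1} · N_{k−2r}, where by convention N_0 = 0. -/
variable {V : Type*}

/-- `f : Fin (k+1) → V` is a walk of length `k` in `G`: consecutive vertices are adjacent. -/
def IsWalkFun (G : SimpleGraph V) (k : ℕ) (f : Fin (k + 1) → V) : Prop :=
  ∀ i : ℕ, ∀ h : i < k, G.Adj (f ⟨i, by omega⟩) (f ⟨i + 1, by omega⟩)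

/-- The walk is non-backtracking: `v_{i-1} ≠ v_{i+1}` for `1 ≤ i ≤ k-1`. -/
def IsNonBacktracking (k : ℕ) (f : Fin (k + 1) → V) : Prop :=
  ∀ i : ℕ, 1 ≤ i → ∀ h : i < k, f ⟨i - 1, by omega⟩ ≠ f ⟨i + 1, by omega⟩

/-- A closed non-backtracking walk of length `k` (possibly with a "tail", i.e. no
condition relating `v_1` and `v_{k-1}`). -/
def IsClosedNBWalk (G : SimpleGraph V) (k : ℕ) (f : Fin (k + 1) → V) : Prop :=
  IsWalkFun G k f ∧ IsNonBacktracking k f ∧ f (Fin.last k) = f 0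

/-- A rooted non-backtracking cycle of length `k`: a closed non-backtracking walk
with the extra condition `v_1 ≠ v_{k-1}`. -/
def IsNBCycle (G : SimpleGraph V) (k : ℕ) (f : Fin (k + 1) → V) : Prop :=
  IsClosedNBWalk G k f ∧ f ⟨1 % (k + 1), Nat.mod_lt 1 k.succ_pos⟩ ≠ f ⟨k - 1, by omega⟩

/-- `N_k`: the number of rooted non-backtracking cycles of length `k` in `G`. -/
noncomputable def nbCycleCount (G : SimpleGraph V) (k : ℕ) : ℕ :=
  Nat.card { f : Fin (k + 1) → V // IsNBCycle G k f }

/-- `M_k`: the number of closed non-backtracking walks of length `k` in `G`. -/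
noncomputable def closedNBWalkCount (G : SimpleGraph V) (k : ℕ) : ℕ :=
  Nat.card { f : Fin (k + 1) → V // IsClosedNBWalk G k f }

/-- A closed non-backtracking walk with a tail: `v_1 = v_{k-1}`. -/
def IsTailedNBWalk (G : SimpleGraph V) (k : ℕ) (f : Fin (k + 1) → V) : Prop :=
  IsClosedNBWalk G k f ∧ f ⟨1 % (k + 1), Nat.mod_lt 1 k.succ_pos⟩ = f ⟨k - 1, by omega⟩

/-- The number of closed non-backtracking walks of length `k` with a tail. -/
noncomputable def tailedNBWalkCount (G : SimpleGraph V) (k : ℕ) : ℕ :=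
  Nat.card { f : Fin (k + 1) → V // IsTailedNBWalk G k f }

theorem natCard_subtype_eq_sum {α : Type*} [Fintype α] (p : α → Prop) [DecidablePred p] :
    Nat.card { a // p a } = ∑ a, if p a then 1 else 0 := by
  rw [Nat.card_eq_fintype_card, Fintype.card_subtype, Finset.card_filter]

theorem closedNBWalkCount_eq_add (G : SimpleGraph V) [Fintype V] (k : ℕ) :
    closedNBWalkCount G k = nbCycleCount G k + tailedNBWalkCount G k := by
  classical
  rw [closedNBWalkCount, nbCycleCount, tailedNBWalkCount]
  simp only [natCard_subtype_eq_sum]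
  rw [← Finset.sum_add_distrib]
  refine Finset.sum_congr rfl fun f _ => ?_
  simp only [IsNBCycle, IsTailedNBWalk]
  by_cases hf : IsClosedNBWalk G k f <;>
    by_cases h : f ⟨1 % (k + 1), Nat.mod_lt 1 k.succ_pos⟩ = f ⟨k - 1, by omega⟩ <;>
    simp [hf, h]

theorem nbCycleCount_zero (G : SimpleGraph V) : nbCycleCount G 0 = 0 := by
  have : IsEmpty { f : Fin (0 + 1) → V // IsNBCycle G 0 f } := ⟨fun f => f.2.2 rfl⟩
  exact Nat.card_of_isEmpty

theorem tailedNBWalkCount_one (G : SimpleGraph V) : tailedNBWalkCount G 1 = 0 := by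
  have : IsEmpty { f : Fin (1 + 1) → V // IsTailedNBWalk G 1 f } := by
    refine ⟨fun ⟨f, hf⟩ => ?_⟩
    have h := hf.1.1 0 one_pos
    exact h.ne hf.1.2.2.symm
  exact Nat.card_of_isEmpty

theorem tailedNBWalkCount_two (G : SimpleGraph V) : tailedNBWalkCount G 2 = 0 := by
  have : IsEmpty { f : Fin (2 + 1) → V // IsTailedNBWalk G 2 f } := by
    refine ⟨fun ⟨f, hf⟩ => ?_⟩
    exact hf.1.2.1 1 le_rfl one_lt_two hf.1.2.2.symm
  exact Nat.card_of_isEmpty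

/-- `u` can be attached at both ends of the closed walk `w`, giving a tailed walk. -/
def IsTailExtension (G : SimpleGraph V) (m : ℕ) (w : Fin (m + 1) → V) (u : V) : Prop :=
  IsClosedNBWalk G m w ∧ G.Adj (w 0) u ∧
    u ≠ w ⟨1 % (m + 1), Nat.mod_lt 1 m.succ_pos⟩ ∧ u ≠ w ⟨m - 1, by omega⟩

theorem isTailedNBWalk_add_two_iff (G : SimpleGraph V) {m : ℕ} (hm : 1 ≤ m)
    (f : Fin (m + 2 + 1) → V) :
    IsTailedNBWalk G (m + 2) f ↔
      f (Fin.last (m + 2)) = f 0 ∧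
        IsTailExtension G m (fun i => f ⟨i + 1, by omega⟩) (f 0) := by
  obtain ⟨m, rfl⟩ := Nat.exists_eq_add_of_le' hm
  have h1 : 1 % (m + 1 + 2 + 1) = 1 := Nat.mod_eq_of_lt (by omega)
  have h2 : 1 % (m + 1 + 1) = 1 := Nat.mod_eq_of_lt (by omega)
  simp only [IsTailedNBWalk, IsTailExtension, IsClosedNBWalk, h1, h2]
  constructor
  · rintro ⟨⟨hw, hn, hc⟩, ht⟩
    refine ⟨hc, ⟨fun i hi => hw (i + 1) (by omega), fun i hi h => ?_, ht.symm⟩,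
      (hw 0 (by omega)).symm, hn 1 le_rfl (by omega), ?_⟩
    · have := hn (i + 1) (by omega) (by omega)
      convert this using 3
      simp only
      omega
    · rw [← hc]
      exact (hn (m + 2) (by omega) (by omega)).symm
  · rintro ⟨hc, ⟨hw, hn, ht⟩, ha, hb, hd⟩
    refine ⟨⟨fun i hi => ?_, fun i hi h => ?_, hc⟩, ht.symm⟩
    · rcases i with _ | i
      · exact ha.symm
      · by_cases h : i < m + 1
        · exact hw i h
        · obtain rfl : i = m + 1 := by omega
          have ha' : G.Adj (f ⟨m + 1 + 1, by omega⟩) (f (Fin.last (m + 1 + 2))) := by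
            rw [hc]
            exact (congrArg (fun x => G.Adj x (f 0)) ht).mpr ha
          exact ha'
    · obtain ⟨i, rfl⟩ := Nat.exists_eq_add_of_le' hi
      rcases i with _ | i
      · exact hb
      · by_cases h' : i + 1 < m + 1
        · exact hn (i + 1) (by omega) h'
        · obtain rfl : i = m := by omega
          have hd' : f ⟨i + 1, by omega⟩ ≠ f (Fin.last (i + 1 + 2)) := by
            rw [hc]
            exact hd.symm
          exact hd'

/-- Removing the coinciding endpoints of a function on `Fin (m + 3)`. -/
def tailExtensionEquiv {m : ℕ} (P : (Fin (m + 1) → V) → V → Prop) :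
    { f : Fin (m + 2 + 1) → V //
      f (Fin.last (m + 2)) = f 0 ∧ P (fun i => f ⟨i + 1, by omega⟩) (f 0) } ≃
      Σ w : Fin (m + 1) → V, { u // P w u } where
  toFun f := ⟨fun i => f.1 ⟨i + 1, by omega⟩, f.1 0, f.2.2⟩
  invFun p := ⟨fun i => if h : 1 ≤ (i : ℕ) ∧ (i : ℕ) ≤ m + 1 then p.1 ⟨i - 1, by omega⟩ else p.2.1,
    by simp, by
      convert p.2.2 using 1
      · funext i
        simp only [Nat.le_add_left, Nat.add_sub_cancel, true_and]
        rw [dif_pos (by omega)]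
      · simp⟩
  left_inv := by
    rintro ⟨f, hf, hP⟩
    refine Subtype.ext (funext fun i => ?_)
    dsimp only
    split_ifs with h
    · congr 1
      exact Fin.ext (Nat.sub_add_cancel h.1)
    · rcases Nat.eq_zero_or_pos i with hi | hi
      · exact congrArg f (Fin.ext hi.symm)
      · rw [← hf]
        exact congrArg f (Fin.ext (by simp only [Fin.val_last]; omega))
  right_inv := by
    rintro ⟨w, u, hP⟩
    have hw : (fun i : Fin (m + 1) => if h : 1 ≤ (i : ℕ) + 1 ∧ (i : ℕ) + 1 ≤ m + 1 then
        w ⟨(i : ℕ) + 1 - 1, by omega⟩ else u) = w := by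
      funext i
      rw [dif_pos (by omega)]
      rfl
    refine Sigma.subtype_ext hw ?_
    simp

theorem natCard_isTailExtension (G : SimpleGraph V) [Fintype V] [DecidableRel G.Adj] {d : ℕ}
    (hreg : G.IsRegularOfDegree d) {m : ℕ} (hm : 1 ≤ m) (w : Fin (m + 1) → V)
    [Decidable (IsNBCycle G m w)] [Decidable (IsTailedNBWalk G m w)] :
    Nat.card { u // IsTailExtension G m w u } =
      (d - 2) * (if IsNBCycle G m w then 1 else 0) +
        (d - 1) * (if IsTailedNBWalk G m w then 1 else 0) := by
  classical
  by_cases hw : IsClosedNBWalk G m w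
  · simp only [IsTailExtension, IsNBCycle, IsTailedNBWalk, hw, true_and]
    have ha : G.Adj (w 0) (w ⟨1 % (m + 1), Nat.mod_lt 1 m.succ_pos⟩) := by
      have h1 : 1 % (m + 1) = 1 := Nat.mod_eq_of_lt (by omega)
      simp only [h1]
      exact hw.1 0 hm
    have hb : G.Adj (w 0) (w ⟨m - 1, by omega⟩) := by
      rw [← hw.2.2]
      convert (hw.1 (m - 1) (by omega)).symm using 3
      simp only [Fin.val_last]
      omega
    generalize w ⟨1 % (m + 1), Nat.mod_lt 1 m.succ_pos⟩ = a at *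
    generalize w ⟨m - 1, by omega⟩ = b at *
    have hset : Finset.univ.filter (fun u => G.Adj (w 0) u ∧ u ≠ a ∧ u ≠ b) =
        ((G.neighborFinset (w 0)).erase a).erase b := by
      ext u
      simp only [Finset.mem_filter, Finset.mem_univ, true_and, Finset.mem_erase,
        SimpleGraph.mem_neighborFinset]
      tauto
    have hcard : ((G.neighborFinset (w 0)).erase a).card = d - 1 := by
      rw [Finset.card_erase_of_mem (by simpa using ha), G.card_neighborFinset_eq_degree, hreg]
    rw [Nat.card_eq_fintype_card, Fintype.card_subtype, hset]
    by_cases hab : a = b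
    · subst hab
      simp [hcard]
    · rw [Finset.card_erase_of_mem (by simpa [Ne.symm hab] using hb), hcard]
      simp [hab, Nat.sub_sub]
  · simp [IsTailExtension, IsNBCycle, IsTailedNBWalk, hw]

theorem tailedNBWalkCount_add_two (G : SimpleGraph V) [Fintype V] [DecidableRel G.Adj] {d : ℕ}
    (hreg : G.IsRegularOfDegree d) {m : ℕ} (hm : 1 ≤ m) :
    tailedNBWalkCount G (m + 2) =
      (d - 2) * nbCycleCount G m + (d - 1) * tailedNBWalkCount G m := by
  classical
  rw [tailedNBWalkCount, Nat.card_congr ((Equiv.subtypeEquivRight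
    (isTailedNBWalk_add_two_iff G hm)).trans (tailExtensionEquiv (IsTailExtension G m))),
    Nat.card_sigma]
  simp only [natCard_isTailExtension G hreg hm]
  rw [Finset.sum_add_distrib, ← Finset.mul_sum, ← Finset.mul_sum, nbCycleCount,
    tailedNBWalkCount, natCard_subtype_eq_sum, natCard_subtype_eq_sum]

theorem tailedNBWalkCount_eq_sum (G : SimpleGraph V) [Fintype V] [DecidableRel G.Adj] {d : ℕ}
    (hreg : G.IsRegularOfDegree d) : ∀ {k : ℕ}, 1 ≤ k →
    tailedNBWalkCount G k =
      ∑ r ∈ Finset.range (k / 2), (d - 2) * (d - 1) ^ r * nbCycleCount G (k - 2 * (r + 1))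
  | 1, _ => by simp [tailedNBWalkCount_one]
  | 2, _ => by simp [tailedNBWalkCount_two, nbCycleCount_zero]
  | m + 3, _ => by
    rw [tailedNBWalkCount_add_two G hreg (m := m + 1) (by omega),
      tailedNBWalkCount_eq_sum G hreg (k := m + 1) (by omega),
      show (m + 3) / 2 = (m + 1) / 2 + 1 by omega, Finset.sum_range_succ', add_comm,
      Finset.mul_sum]
    congr 1
    · refine Finset.sum_congr rfl fun r _ => ?_
      rw [show m + 3 - 2 * (r + 1 + 1) = m + 1 - 2 * (r + 1) by omega]
      ring
    · simp

theorem tailed_walk_count_eq (G : SimpleGraph V) [Fintype V] [DecidableRel G.Adj] (d : ℕ) (hd : 2 ≤ d)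
    (hreg : G.IsRegularOfDegree d) (k : ℕ) (hk : 3 ≤ k) :
    closedNBWalkCount G k =
      nbCycleCount G k +
        ∑ r ∈ Finset.Icc 1 (k / 2),
          (d - 2) * (d - 1) ^ (r - 1) * nbCycleCount G (k - 2 * r) := by
  rw [closedNBWalkCount_eq_add, tailedNBWalkCount_eq_sum G hreg (by omega), Finset.range_eq_Ico]
  congr 1
  exact Finset.sum_Ico_add'
    (fun r => (d - 2) * (d - 1) ^ (r - 1) * nbCycleCount G (k - 2 * r)) 0 (k / 2) 1
end

section
/- Let d ≥ 2 and let G be a finite simple d-regular graph with adjacency matrix A, regarded as a real matrix. For every k ≥ 0, Σ_{0 ≤ j ≤ ⌊k/2⌋} A_{k−2j} = (√(d−1))^k · U_k( A / (2√(d−1)) ), where U_k is evaluated at the matrix A/(2√(d−1)). -/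
variable {V : Type*}

/-- `A_k`: the integer matrix whose `(v, w)` entry is the number of non-backtracking
walks of length `k` in `G` from `v` to `w`. -/
noncomputable def nbWalkMatrix (G : SimpleGraph V) [Fintype V] (k : ℕ) : Matrix V V ℤ :=
  Matrix.of fun v w =>
    (Nat.card { f : Fin (k + 1) → V //
      IsWalkFun G k f ∧ IsNonBacktracking k f ∧ f 0 = v ∧ f (Fin.last k) = w } : ℤ)

/-- `A_k` regarded as a real matrix. -/
noncomputable def nbWalkMatrixR (G : SimpleGraph V) [Fintype V] (k : ℕ) : Matrix V V ℝ :=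
  Matrix.of fun v w =>
    (Nat.card { f : Fin (k + 1) → V //
      IsWalkFun G k f ∧ IsNonBacktracking k f ∧ f 0 = v ∧ f (Fin.last k) = w } : ℝ)

/-- The number of non-backtracking walks of length `k + 1` with first vertex `a`, second vertex `b`
and last vertex `w`, as a real number. -/
noncomputable def nbWalkCountFrom (G : SimpleGraph V) [Fintype V] (k : ℕ) (a b w : V) : ℝ :=
  open scoped Classical in
  ∑ g : Fin (k + 1) → V,
    if (IsWalkFun G (k + 1) (Fin.cons a g) ∧ IsNonBacktracking (k + 1) (Fin.cons a g)) ∧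
      g 0 = b ∧ g (Fin.last k) = w then 1 else 0

theorem isWalkFun_cons (G : SimpleGraph V) (k : ℕ) (a : V) (g : Fin (k + 1) → V) :
    IsWalkFun G (k + 1) (Fin.cons a g) ↔ G.Adj a (g 0) ∧ IsWalkFun G k g := by
  constructor
  · intro h
    exact ⟨h 0 k.succ_pos, fun i hi => h (i + 1) (Nat.succ_lt_succ hi)⟩
  · rintro ⟨h0, h⟩ i hi
    cases i with
    | zero => exact h0
    | succ i => exact h i (by omega)

theorem isNonBacktracking_cons (k : ℕ) (a b : V) (g : Fin (k + 1) → V) :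
    IsNonBacktracking (k + 2) (Fin.cons a (Fin.cons b g : Fin (k + 2) → V)) ↔
      a ≠ g 0 ∧ IsNonBacktracking (k + 1) (Fin.cons b g) := by
  constructor
  · intro h
    refine ⟨h 1 le_rfl (Nat.succ_lt_succ k.succ_pos), fun i h1 hi => ?_⟩
    obtain ⟨i, rfl⟩ : ∃ j, i = j + 1 := ⟨i - 1, by omega⟩
    exact h (i + 2) (by omega) (by omega)
  · rintro ⟨h0, h⟩ i h1 hi
    obtain ⟨i, rfl⟩ : ∃ j, i = j + 1 := ⟨i - 1, by omega⟩
    cases i with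
    | zero => exact h0
    | succ i => exact h (i + 1) (by omega) (by omega)

theorem sum_fin_succ_eq_sum_cons [Fintype V] [DecidableEq V] {M : Type*} [AddCommMonoid M]
    (k : ℕ) (F : (Fin (k + 1) → V) → M) :
    ∑ f, F f = ∑ x : V, ∑ g : Fin k → V, F (Fin.cons x g) := by
  rw [← Fintype.sum_prod_type', ← (Fin.consEquiv fun _ : Fin (k + 1) => V).sum_comp]
  rfl

theorem nbWalkMatrixR_zero (G : SimpleGraph V) [Fintype V] [DecidableEq V] :
    nbWalkMatrixR G 0 = 1 := by
  classical
  ext v w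
  simp only [nbWalkMatrixR, Matrix.of_apply, Nat.card_eq_fintype_card, Fintype.card_subtype,
    Finset.card_filter, Nat.cast_sum, Nat.cast_ite, Nat.cast_one, Nat.cast_zero]
  rw [sum_fin_succ_eq_sum_cons]
  have hW (f : Fin (0 + 1) → V) : IsWalkFun G 0 f := fun i hi => absurd hi (by omega)
  have hN (f : Fin (0 + 1) → V) : IsNonBacktracking 0 f := fun i _ hi => absurd hi (by omega)
  simp [hW, hN, Matrix.one_apply, ite_and]

theorem nbWalkMatrixR_succ_apply (G : SimpleGraph V) [Fintype V] (k : ℕ) (a w : V) :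
    nbWalkMatrixR G (k + 1) a w = ∑ b, nbWalkCountFrom G k a b w := by
  classical
  simp only [nbWalkMatrixR, nbWalkCountFrom, Matrix.of_apply, Nat.card_eq_fintype_card,
    Fintype.card_subtype, Finset.card_filter, Nat.cast_sum, Nat.cast_ite, Nat.cast_one,
    Nat.cast_zero]
  rw [sum_fin_succ_eq_sum_cons, Finset.sum_comm, Finset.sum_comm (s := Finset.univ (α := V))]
  refine Finset.sum_congr rfl fun g _ => ?_
  rw [Finset.sum_eq_single a (fun x _ hx => by simp [hx]) (by simp),
    Finset.sum_eq_single (g 0) (fun x _ hx => by simp [hx.symm]) (by simp)]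
  simp [← Fin.succ_last, and_assoc]

theorem nbWalkCountFrom_zero (G : SimpleGraph V) [Fintype V] [DecidableEq V] [DecidableRel G.Adj]
    (a b w : V) :
    nbWalkCountFrom G 0 a b w = G.adjMatrix ℝ a b * (1 : Matrix V V ℝ) b w := by
  classical
  rw [nbWalkCountFrom, sum_fin_succ_eq_sum_cons]
  have hW (f : Fin (0 + 1) → V) : IsWalkFun G 0 f := fun i hi => absurd hi (by omega)
  have hN (f : Fin (0 + 1 + 1) → V) : IsNonBacktracking (0 + 1) f :=
    fun i h1 hi => absurd hi (by omega)
  rw [Finset.sum_eq_single b (fun x _ hx => by simp [hx]) (by simp)]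
  by_cases h : G.Adj a b <;> simp [hW, hN, isWalkFun_cons, Matrix.one_apply, h]

theorem nbWalkCountFrom_succ (G : SimpleGraph V) [Fintype V] [DecidableRel G.Adj]
    (k : ℕ) (a b w : V) :
    nbWalkCountFrom G (k + 1) a b w =
      G.adjMatrix ℝ a b * (nbWalkMatrixR G (k + 1) b w - nbWalkCountFrom G k b a w) := by
  classical
  rw [nbWalkMatrixR_succ_apply]
  simp only [nbWalkCountFrom]
  rw [sum_fin_succ_eq_sum_cons, Finset.sum_comm, Finset.sum_comm (s := Finset.univ (α := V)),
    ← Finset.sum_sub_distrib, Finset.mul_sum]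
  refine Finset.sum_congr rfl fun g _ => ?_
  rw [Finset.sum_eq_single b (fun x _ hx => by simp [hx]) (by simp),
    Finset.sum_eq_single (g 0) (fun x _ hx => by simp [hx.symm]) (by simp),
    isWalkFun_cons, isNonBacktracking_cons, SimpleGraph.adjMatrix_apply, ← Fin.succ_last,
    Fin.cons_succ, Fin.cons_zero]
  by_cases h1 : G.Adj a b <;> by_cases h2 : a = g 0 <;> simp [h1, h2, eq_comm]

theorem nbWalkMatrixR_add_two_apply (G : SimpleGraph V) [Fintype V] [DecidableRel G.Adj]
    (k : ℕ) (a w : V) :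
    nbWalkMatrixR G (k + 2) a w = (G.adjMatrix ℝ * nbWalkMatrixR G (k + 1)) a w -
      ∑ b, G.adjMatrix ℝ a b * nbWalkCountFrom G k b a w := by
  simp only [nbWalkMatrixR_succ_apply G (k + 1), nbWalkCountFrom_succ, mul_sub,
    Finset.sum_sub_distrib, Matrix.mul_apply]

theorem nbWalkMatrixR_one (G : SimpleGraph V) [Fintype V] [DecidableRel G.Adj] :
    nbWalkMatrixR G 1 = G.adjMatrix ℝ := by
  classical
  ext a w
  rw [nbWalkMatrixR_succ_apply]
  simp only [nbWalkCountFrom_zero]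
  rw [← Matrix.mul_apply, mul_one]

theorem sum_adjMatrix_apply_of_regular (G : SimpleGraph V) [Fintype V] [DecidableRel G.Adj]
    {d : ℕ} (hreg : G.IsRegularOfDegree d) (a : V) : ∑ b, G.adjMatrix ℝ a b = d := by
  simp [SimpleGraph.adjMatrix_apply, ← hreg a, ← SimpleGraph.card_neighborFinset_eq_degree,
    SimpleGraph.neighborFinset_eq_filter]

theorem nbWalkMatrixR_two (G : SimpleGraph V) [Fintype V] [DecidableEq V] [DecidableRel G.Adj]
    {d : ℕ} (hreg : G.IsRegularOfDegree d) :
    nbWalkMatrixR G 2 = G.adjMatrix ℝ * G.adjMatrix ℝ - (d : ℝ) • 1 := by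
  ext a w
  rw [nbWalkMatrixR_add_two_apply, nbWalkMatrixR_one]
  simp only [Matrix.sub_apply, Matrix.smul_apply, smul_eq_mul, nbWalkCountFrom_zero]
  rw [← sum_adjMatrix_apply_of_regular G hreg a, Finset.sum_mul]
  congr 1
  refine Finset.sum_congr rfl fun b _ => ?_
  by_cases h : G.Adj a b <;> simp [h, G.adj_comm b a]

theorem nbWalkMatrixR_add_three (G : SimpleGraph V) [Fintype V] [DecidableRel G.Adj]
    {d : ℕ} (hreg : G.IsRegularOfDegree d) (k : ℕ) :
    nbWalkMatrixR G (k + 3) = G.adjMatrix ℝ * nbWalkMatrixR G (k + 2) -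
      ((d : ℝ) - 1) • nbWalkMatrixR G (k + 1) := by
  classical
  ext a w
  have hsupp (b : V) : G.adjMatrix ℝ a b * nbWalkCountFrom G k a b w
      = nbWalkCountFrom G k a b w := by
    cases k with
    | zero => by_cases h : G.Adj a b <;> simp [nbWalkCountFrom_zero, h]
    | succ k => by_cases h : G.Adj a b <;> simp [nbWalkCountFrom_succ, h]
  have key (b : V) : G.adjMatrix ℝ a b * nbWalkCountFrom G (k + 1) b a w =
      G.adjMatrix ℝ a b * nbWalkMatrixR G (k + 1) a w - nbWalkCountFrom G k a b w := by
    rw [nbWalkCountFrom_succ]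
    have hb := hsupp b
    rw [SimpleGraph.adjMatrix_apply] at hb
    by_cases h : G.Adj a b
    · simp [h, h.symm]
    · rw [if_neg h, zero_mul] at hb
      simp [← hb, h]
  rw [nbWalkMatrixR_add_two_apply G (k + 1)]
  simp only [key, Finset.sum_sub_distrib, ← Finset.sum_mul, ← nbWalkMatrixR_succ_apply,
    sum_adjMatrix_apply_of_regular G hreg, Matrix.sub_apply, Matrix.smul_apply, smul_eq_mul]
  ring

theorem sum_nbWalkMatrixR_add_two (G : SimpleGraph V) [Fintype V] (k : ℕ) :
    ∑ j ∈ Finset.range ((k + 2) / 2 + 1), nbWalkMatrixR G (k + 2 - 2 * j) =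
      nbWalkMatrixR G (k + 2) + ∑ j ∈ Finset.range (k / 2 + 1), nbWalkMatrixR G (k - 2 * j) := by
  rw [show (k + 2) / 2 + 1 = (k / 2 + 1) + 1 by omega, Finset.sum_range_succ', add_comm]
  congr 1
  refine Finset.sum_congr rfl fun j _ => ?_
  congr 1
  omega

theorem sum_nbWalkMatrixR_recurrence (G : SimpleGraph V) [Fintype V] [DecidableRel G.Adj]
    {d : ℕ} (hreg : G.IsRegularOfDegree d) (k : ℕ) :
    ∑ j ∈ Finset.range ((k + 2) / 2 + 1), nbWalkMatrixR G (k + 2 - 2 * j) =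
      G.adjMatrix ℝ *
          ∑ j ∈ Finset.range ((k + 1) / 2 + 1), nbWalkMatrixR G (k + 1 - 2 * j) -
        ((d : ℝ) - 1) • ∑ j ∈ Finset.range (k / 2 + 1), nbWalkMatrixR G (k - 2 * j) := by
  classical
  induction k using Nat.twoStepInduction with
  | zero =>
    rw [sum_nbWalkMatrixR_add_two]
    simp [nbWalkMatrixR_zero, nbWalkMatrixR_one, nbWalkMatrixR_two G hreg, sub_smul]
    abel
  | one =>
    rw [sum_nbWalkMatrixR_add_two, sum_nbWalkMatrixR_add_two G 0, nbWalkMatrixR_add_three G hreg 0]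
    simp [nbWalkMatrixR_zero, nbWalkMatrixR_one, mul_add, sub_smul]
    abel
  | more k ih _ =>
    conv_lhs => rw [sum_nbWalkMatrixR_add_two G (k + 2), ih, nbWalkMatrixR_add_three G hreg (k + 1)]
    conv_rhs => rw [sum_nbWalkMatrixR_add_two G (k + 1), sum_nbWalkMatrixR_add_two G k, mul_add,
      smul_add]
    abel

open Polynomial in
theorem nbWalkMatrix_sum_eq_chebyshevU (G : SimpleGraph V) [Fintype V] [DecidableEq V]
    [DecidableRel G.Adj] (d : ℕ) (hd : 2 ≤ d) (hreg : G.IsRegularOfDegree d) (k : ℕ) :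
    ∑ j ∈ Finset.range (k / 2 + 1), nbWalkMatrixR G (k - 2 * j) =
      (Real.sqrt ((d : ℝ) - 1)) ^ k •
        Polynomial.aeval ((2 * Real.sqrt ((d : ℝ) - 1))⁻¹ • G.adjMatrix ℝ)
          (Polynomial.Chebyshev.U ℝ (k : ℤ)) := by
  have hpos : 0 < Real.sqrt ((d : ℝ) - 1) := by
    have : (2 : ℝ) ≤ d := by exact_mod_cast hd
    exact Real.sqrt_pos.mpr (by linarith)
  have hsq : (d : ℝ) - 1 = Real.sqrt ((d : ℝ) - 1) ^ 2 :=
    (Real.sq_sqrt (Real.sqrt_pos.mp hpos).le).symm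
  induction k using Nat.twoStepInduction with
  | zero => simp [nbWalkMatrixR_zero]
  | one =>
    have h2 : (2 : Polynomial ℝ) = Polynomial.C 2 := rfl
    simp only [Nat.cast_one, Polynomial.Chebyshev.U_one, h2, map_mul, Polynomial.aeval_C,
      Polynomial.aeval_X, Algebra.algebraMap_eq_smul_one, smul_mul_assoc, one_mul, smul_smul]
    rw [show Real.sqrt ((d : ℝ) - 1) ^ 1 * (2 * (2 * Real.sqrt ((d : ℝ) - 1))⁻¹) = 1 by
      field_simp]
    simp [nbWalkMatrixR_one]
  | more k ih0 ih1 =>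
    have h2 : (2 : Polynomial ℝ) = Polynomial.C 2 := rfl
    rw [sum_nbWalkMatrixR_recurrence G hreg, ih0, ih1]
    push_cast
    rw [Polynomial.Chebyshev.U_add_two]
    simp only [h2, map_sub, map_mul, Polynomial.aeval_C,
      Polynomial.aeval_X, Algebra.algebraMap_eq_smul_one, smul_mul_assoc, one_mul, smul_smul,
      smul_sub, mul_smul_comm]
    congr 2
    · field_simp
      ring
    · nth_rewrite 1 [hsq]
      ring
end

section
/- Let d ≥ 2 and let G be a finite simple d-regular graph with n vertices and adjacency matrix A, regarded as a real matrix. For every k ≥ 1: if k is odd then N_k = 2(√(d−1))^k · Tr( T_k( A/(2√(d−1)) ) ), and if k is even then N_k = n(d−2) + 2(√(d−1))^k · Tr( T_k( A/(2√(d−1)) ) ), where T_k is evaluated at the matrix A/(2√(d−1)). -/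
variable {V : Type*}

open scoped Matrix

section PowerSums

variable {ι R : Type*} [Fintype ι] [DecidableEq ι] [CommSemiring R]

/-- The entries of the power of a matrix as a sum of weights over walks on the index set. -/
theorem Matrix.pow_apply_eq_sum_walks (M : Matrix ι ι R) (k : ℕ) (x y : ι) :
    (M ^ k) x y = ∑ f : Fin (k + 1) → ι,
      if f 0 = x ∧ f (Fin.last k) = y then ∏ i : Fin k, M (f i.castSucc) (f i.succ) else 0 := by
  induction k generalizing x with
  | zero =>
    rw [← (Equiv.funUnique (Fin 1) ι).symm.sum_comp]
    simp [Matrix.one_apply, ite_and]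
  | succ k ih =>
    rw [pow_succ', Matrix.mul_apply, ← (Fin.consEquiv fun _ => ι).sum_comp, Fintype.sum_prod_type]
    simp_rw [ih, Finset.mul_sum]
    rw [Finset.sum_comm]
    conv_rhs => rw [Finset.sum_comm]
    refine Finset.sum_congr rfl fun f _ => ?_
    simp [Fin.consEquiv, Fin.prod_univ_succ, ← Fin.succ_last, ite_and]

theorem Matrix.trace_pow_eq_sum_closed_walks (M : Matrix ι ι R) (k : ℕ) :
    (M ^ k).trace = ∑ f : Fin (k + 1) → ι,
      if f (Fin.last k) = f 0 then ∏ i : Fin k, M (f i.castSucc) (f i.succ) else 0 := by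
  simp_rw [Matrix.trace, Matrix.diag_apply, Matrix.pow_apply_eq_sum_walks]
  rw [Finset.sum_comm]
  refine Finset.sum_congr rfl fun f _ => ?_
  simp [ite_and]

end PowerSums

namespace SimpleGraph

variable (G : SimpleGraph V)

/-- The dart `b` may follow the dart `a` in a non-backtracking walk. -/
def NBAdj (a b : G.Dart) : Prop := a.snd = b.fst ∧ a.fst ≠ b.snd

/-- The vertices of a closed walk of darts form a rooted non-backtracking cycle. -/
theorem isNBCycle_of_dartWalk {k : ℕ} (hk : 1 ≤ k) (f : Fin (k + 1) → G.Dart)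
    (hc : f (Fin.last k) = f 0) (hf : ∀ i : Fin k, G.NBAdj (f i.castSucc) (f i.succ)) :
    IsNBCycle G k fun i => (f i).fst := by
  have hs (i : ℕ) (h : i < k) : (f ⟨i, by omega⟩).snd = (f ⟨i + 1, by omega⟩).fst := (hf ⟨i, h⟩).1
  have hn (i : ℕ) (h : i < k) : (f ⟨i, by omega⟩).fst ≠ (f ⟨i + 1, by omega⟩).snd := (hf ⟨i, h⟩).2
  refine ⟨⟨fun i h => ?_, fun i hi h => ?_, by simp [hc]⟩, ?_⟩
  · have := (f ⟨i, by omega⟩).adj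
    rwa [hs i h] at this
  · obtain ⟨i, rfl⟩ := Nat.exists_eq_add_of_le' hi
    have := hn i (by omega)
    rw [hs (i + 1) h] at this
    exact this
  · obtain ⟨k, rfl⟩ := Nat.exists_eq_add_of_le' hk
    have h1 := hn k (by omega)
    have h2 := hs 0 (by omega)
    change f ⟨k + 1, _⟩ = f ⟨0, _⟩ at hc
    rw [hc, h2] at h1
    simpa using h1.symm

theorem bijective_dartWalk_to_nbCycle {k : ℕ} (hk : 1 ≤ k) :
    Function.Bijective (fun f : { f : Fin (k + 1) → G.Dart //
        f (Fin.last k) = f 0 ∧ ∀ i : Fin k, G.NBAdj (f i.castSucc) (f i.succ) } =>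
      (⟨fun i => (f.1 i).fst, G.isNBCycle_of_dartWalk hk f.1 f.2.1 f.2.2⟩ :
        { v : Fin (k + 1) → V // IsNBCycle G k v })) := by
  constructor
  · rintro ⟨f, hf, hf'⟩ ⟨g, hg, hg'⟩ h
    have hfg : ∀ i, (f i).fst = (g i).fst := fun i => congrFun (congrArg Subtype.val h) i
    have hcast : ∀ i : Fin k, f i.castSucc = g i.castSucc := fun i =>
      Dart.ext _ _ (Prod.ext (hfg _) (by
        have := hfg i.succ
        rwa [← (hf' i).1, ← (hg' i).1] at this))
    refine Subtype.ext (funext fun i => ?_)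
    induction i using Fin.lastCases with
    | cast i => exact hcast i
    | last =>
      change f _ = g _
      rw [hf, hg]
      exact hcast ⟨0, hk⟩
  · rintro ⟨v, ⟨hw, hnb, hc⟩, ht⟩
    have hmod : ∀ i : ℕ, i % k < k := fun i => Nat.mod_lt i hk
    refine ⟨⟨fun i => ⟨(v ⟨i % k, by have := hmod i; omega⟩,
      v ⟨i % k + 1, by have := hmod i; omega⟩), hw _ (hmod i)⟩, ?_, fun i => ?_⟩, ?_⟩
    · simp
    · have hik : (i : ℕ) % k = i := Nat.mod_eq_of_lt i.2
      rcases Nat.lt_or_ge (i + 1) k with h | h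
      · have hik' : ((i : ℕ) + 1) % k = i + 1 := Nat.mod_eq_of_lt h
        have := hnb (i + 1) (by omega) h
        simpa [NBAdj, hik, hik'] using this
      · have hi : (i : ℕ) + 1 = k := by omega
        have hki : k - 1 = i := by omega
        have h1 : 1 % (k + 1) = 1 := Nat.mod_eq_of_lt (by omega)
        have hc' : v ⟨k, by omega⟩ = v ⟨0, by omega⟩ := hc
        simp only [h1, hki] at ht
        simpa [NBAdj, hik, hi, hc'] using ht.symm
    · refine Subtype.ext (funext fun i => ?_)
      rcases Nat.lt_or_ge i k with h | h
      · simp [Nat.mod_eq_of_lt h]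
      · obtain rfl : i = Fin.last k := Fin.ext (by simp; omega)
        simp [hc]

variable [Fintype V] [DecidableEq V] [DecidableRel G.Adj]

/-- The incidence matrix of vertices and darts starting at them. -/
def dartSource : Matrix V G.Dart ℝ := Matrix.of fun v e => if e.fst = v then 1 else 0

/-- The incidence matrix of vertices and darts ending at them. -/
def dartTarget : Matrix V G.Dart ℝ := Matrix.of fun v e => if e.snd = v then 1 else 0

/-- The permutation matrix of dart reversal. -/
def dartFlip : Matrix G.Dart G.Dart ℝ := Matrix.of fun e f => if e.symm = f then 1 else 0

/-- The non-backtracking (Hashimoto) matrix. -/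
def nbMatrix : Matrix G.Dart G.Dart ℝ := G.dartTargetᵀ * G.dartSource - G.dartFlip

instance : DecidableRel G.NBAdj := fun _ _ => instDecidableAnd

omit [DecidableRel G.Adj] in
theorem nbMatrix_apply (e f : G.Dart) : G.nbMatrix e f = if G.NBAdj e f then 1 else 0 := by
  have hsymm : e.symm = f ↔ e.snd = f.fst ∧ e.fst = f.snd := by
    rw [Dart.ext_iff, Prod.ext_iff]
    rfl
  simp only [nbMatrix, dartTarget, dartSource, dartFlip, Matrix.sub_apply, Matrix.mul_apply,
    Matrix.transpose_apply, Matrix.of_apply, hsymm, NBAdj]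
  by_cases h1 : e.snd = f.fst <;> by_cases h2 : e.fst = f.snd <;>
    simp [h1, h2, eq_comm (a := f.fst)]

theorem nbCycleCount_eq_trace_nbMatrix_pow {k : ℕ} (hk : 1 ≤ k) :
    (nbCycleCount G k : ℝ) = (G.nbMatrix ^ k).trace := by
  classical
  rw [nbCycleCount, ← Nat.card_eq_of_bijective _ (G.bijective_dartWalk_to_nbCycle hk),
    Matrix.trace_pow_eq_sum_closed_walks, Nat.card_eq_fintype_card, Fintype.card_subtype,
    Finset.card_filter]
  push_cast
  refine Finset.sum_congr rfl fun f _ => ?_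
  simp [nbMatrix_apply, Finset.prod_ite_zero, ite_and]

theorem dartSource_mul_dartTarget_transpose :
    G.dartSource * G.dartTargetᵀ = G.adjMatrix ℝ := by
  ext v w
  simp only [dartSource, dartTarget, Matrix.mul_apply, Matrix.transpose_apply, Matrix.of_apply,
    adjMatrix_apply, mul_ite, mul_one, mul_zero, ← ite_and]
  by_cases h : G.Adj v w
  · rw [if_pos h, Finset.sum_eq_single ⟨(v, w), h⟩ (fun e _ he => if_neg fun h' =>
      he (Dart.ext _ _ (Prod.ext h'.2 h'.1)))] <;> simp
  · rw [if_neg h]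
    refine Finset.sum_eq_zero fun e _ => if_neg ?_
    rintro ⟨rfl, rfl⟩
    exact h e.adj

theorem dartSource_mul_dartFlip : G.dartSource * G.dartFlip = G.dartTarget := by
  ext v e
  simp only [dartSource, dartTarget, dartFlip, Matrix.mul_apply, Matrix.of_apply,
    Dart.symm_involutive.eq_iff]
  simp

theorem dartFlip_mul_dartFlip : G.dartFlip * G.dartFlip = 1 := by
  ext e f
  simp only [dartFlip, Matrix.mul_apply, Matrix.of_apply, Matrix.one_apply, ite_mul, one_mul,
    zero_mul, Finset.sum_ite_eq, Finset.mem_univ, if_true, Dart.symm_symm]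

theorem dartTarget_mul_dartFlip : G.dartTarget * G.dartFlip = G.dartSource := by
  rw [← dartSource_mul_dartFlip, Matrix.mul_assoc, dartFlip_mul_dartFlip, Matrix.mul_one]

omit [Fintype V] [DecidableRel G.Adj] in
theorem dartFlip_transpose : G.dartFlipᵀ = G.dartFlip := by
  ext e f
  simp only [dartFlip, Matrix.transpose_apply, Matrix.of_apply]
  exact if_congr (Dart.symm_involutive.eq_iff.trans eq_comm) rfl rfl

theorem dartFlip_mul_dartTarget_transpose : G.dartFlip * G.dartTargetᵀ = G.dartSourceᵀ := by
  rw [← dartTarget_mul_dartFlip, Matrix.transpose_mul, dartFlip_transpose]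

theorem trace_nbMatrix_pow_add_two (k : ℕ) :
    (G.nbMatrix ^ (k + 2)).trace = (G.nbMatrix ^ k).trace +
      (G.dartSource * G.nbMatrix ^ (k + 1) * G.dartTargetᵀ -
        G.dartSource * G.nbMatrix ^ k * G.dartSourceᵀ).trace := by
  have hflip : G.dartFlip * G.nbMatrix ^ (k + 1) =
      G.dartSourceᵀ * (G.dartSource * G.nbMatrix ^ k) - G.nbMatrix ^ k := by
    rw [pow_succ', ← Matrix.mul_assoc]
    nth_rw 1 [nbMatrix]
    rw [Matrix.mul_sub, ← Matrix.mul_assoc, dartFlip_mul_dartTarget_transpose,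
      dartFlip_mul_dartFlip, Matrix.sub_mul, Matrix.one_mul, Matrix.mul_assoc]
  have hpow : G.nbMatrix ^ (k + 2) = G.dartTargetᵀ * (G.dartSource * G.nbMatrix ^ (k + 1)) -
      G.dartFlip * G.nbMatrix ^ (k + 1) := by
    rw [pow_succ' _ (k + 1)]
    nth_rw 1 [nbMatrix]
    rw [Matrix.sub_mul, Matrix.mul_assoc]
  rw [hpow, hflip, Matrix.trace_sub, Matrix.trace_sub, Matrix.trace_sub,
    Matrix.trace_mul_comm G.dartTargetᵀ, Matrix.trace_mul_comm G.dartSourceᵀ]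
  ring

variable {G} {d : ℕ}

theorem IsRegularOfDegree.dartSource_mul_transpose (hreg : G.IsRegularOfDegree d) :
    G.dartSource * G.dartSourceᵀ = (d : ℝ) • 1 := by
  ext v w
  simp only [dartSource, Matrix.mul_apply, Matrix.transpose_apply, Matrix.of_apply,
    Matrix.smul_apply, Matrix.one_apply, smul_eq_mul, mul_ite, mul_one, mul_zero, ← ite_and]
  by_cases h : v = w
  · subst h
    have := G.dart_fst_fiber_card_eq_degree v
    simp [this, hreg v]
  · rw [if_neg h]
    exact Finset.sum_eq_zero fun e _ => if_neg fun h' => h (by rw [← h'.1, ← h'.2])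

theorem IsRegularOfDegree.dartTarget_mul_transpose (hreg : G.IsRegularOfDegree d) :
    G.dartTarget * G.dartTargetᵀ = (d : ℝ) • 1 := by
  rw [← G.dartSource_mul_dartFlip, Matrix.mul_assoc, G.dartSource_mul_dartFlip,
    dartFlip_mul_dartTarget_transpose, hreg.dartSource_mul_transpose]

theorem dartSource_mul_nbMatrix :
    G.dartSource * G.nbMatrix = G.adjMatrix ℝ * G.dartSource - G.dartTarget := by
  rw [nbMatrix, Matrix.mul_sub, ← Matrix.mul_assoc, dartSource_mul_dartTarget_transpose,
    dartSource_mul_dartFlip]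

theorem IsRegularOfDegree.dartTarget_mul_nbMatrix (hreg : G.IsRegularOfDegree d) :
    G.dartTarget * G.nbMatrix = ((d : ℝ) - 1) • G.dartSource := by
  rw [nbMatrix, Matrix.mul_sub, ← Matrix.mul_assoc, hreg.dartTarget_mul_transpose,
    dartTarget_mul_dartFlip, sub_smul, one_smul, Matrix.smul_mul, Matrix.one_mul]

theorem IsRegularOfDegree.dartSource_mul_nbMatrix_pow_add_two (hreg : G.IsRegularOfDegree d)
    (k : ℕ) : G.dartSource * G.nbMatrix ^ (k + 2) =
      G.adjMatrix ℝ * (G.dartSource * G.nbMatrix ^ (k + 1)) -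
        ((d : ℝ) - 1) • (G.dartSource * G.nbMatrix ^ k) := by
  rw [pow_succ' _ (k + 1), ← Matrix.mul_assoc, dartSource_mul_nbMatrix, Matrix.sub_mul,
    Matrix.mul_assoc, pow_succ' _ k, ← Matrix.mul_assoc G.dartTarget,
    hreg.dartTarget_mul_nbMatrix, Matrix.smul_mul]

/-- The matrices `2 s ^ k T_k(A / (2 s))` satisfy a three-term recurrence. -/
theorem _root_.Matrix.scaled_chebyshevT_add_two (A : Matrix V V ℝ) {s : ℝ} (hs : s ≠ 0) (k : ℕ) :
    (2 * s ^ (k + 2)) • Polynomial.aeval ((2 * s)⁻¹ • A)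
        (Polynomial.Chebyshev.T ℝ ((k + 2 : ℕ) : ℤ)) =
      A * ((2 * s ^ (k + 1)) • Polynomial.aeval ((2 * s)⁻¹ • A)
        (Polynomial.Chebyshev.T ℝ ((k + 1 : ℕ) : ℤ))) -
      s ^ 2 • ((2 * s ^ k) • Polynomial.aeval ((2 * s)⁻¹ • A)
        (Polynomial.Chebyshev.T ℝ (k : ℤ))) := by
  have hX (P : Matrix V V ℝ) : (2 : Matrix V V ℝ) * ((2 * s)⁻¹ • A) * P = s⁻¹ • (A * P) := by
    rw [mul_assoc, two_mul, smul_mul_assoc]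
    match_scalars
    field_simp
    norm_num
  push_cast
  rw [Polynomial.Chebyshev.T_add_two]
  simp only [map_sub, map_mul, Polynomial.aeval_X, map_ofNat]
  rw [hX, Matrix.mul_smul]
  match_scalars <;> field_simp <;> ring

theorem IsRegularOfDegree.nb_sub_eq_scaled_chebyshevT_sub (hreg : G.IsRegularOfDegree d)
    {s : ℝ} (hs : s ≠ 0) (hsd : s ^ 2 = (d : ℝ) - 1) (k : ℕ) :
    G.dartSource * G.nbMatrix ^ (k + 1) * G.dartTargetᵀ -
        G.dartSource * G.nbMatrix ^ k * G.dartSourceᵀ =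
      (2 * s ^ (k + 2)) • Polynomial.aeval ((2 * s)⁻¹ • G.adjMatrix ℝ)
        (Polynomial.Chebyshev.T ℝ ((k + 2 : ℕ) : ℤ)) -
      (2 * s ^ k) • Polynomial.aeval ((2 * s)⁻¹ • G.adjMatrix ℝ)
        (Polynomial.Chebyshev.T ℝ (k : ℤ)) := by
  set C : ℕ → Matrix V V ℝ := fun k => (2 * s ^ k) • Polynomial.aeval
    ((2 * s)⁻¹ • G.adjMatrix ℝ) (Polynomial.Chebyshev.T ℝ (k : ℤ)) with hC
  change _ = C (k + 2) - C k
  have hrec (k : ℕ) : C (k + 2) = G.adjMatrix ℝ * C (k + 1) - ((d : ℝ) - 1) • C k := by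
    rw [← hsd]
    exact Matrix.scaled_chebyshevT_add_two _ hs k
  have h0 : C 0 = (2 : ℝ) • 1 := by simp [hC]
  have h1 : C 1 = G.adjMatrix ℝ := by
    simp only [hC, pow_one, Nat.cast_one, Polynomial.Chebyshev.T_one, Polynomial.aeval_X, smul_smul]
    rw [mul_inv_cancel₀ (by simpa using hs), one_smul]
  induction k using Nat.twoStepInduction with
  | zero =>
    rw [zero_add, zero_add, pow_one, pow_zero, Matrix.mul_one, dartSource_mul_nbMatrix,
      Matrix.sub_mul, Matrix.mul_assoc, dartSource_mul_dartTarget_transpose,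
      hreg.dartTarget_mul_transpose, hreg.dartSource_mul_transpose, hrec, zero_add, h0, h1]
    module
  | one =>
    rw [hreg.dartSource_mul_nbMatrix_pow_add_two 0, zero_add, pow_one, pow_zero, Matrix.mul_one,
      dartSource_mul_nbMatrix, hrec, hrec, zero_add, h0, h1]
    have hTS : G.dartTarget * G.dartSourceᵀ = G.adjMatrix ℝ := by
      rw [← dartFlip_mul_dartTarget_transpose, ← Matrix.mul_assoc, dartTarget_mul_dartFlip,
        dartSource_mul_dartTarget_transpose]
    simp only [Matrix.sub_mul, Matrix.mul_sub, Matrix.mul_assoc, Matrix.smul_mul, Matrix.mul_smul,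
      dartSource_mul_dartTarget_transpose, hTS, hreg.dartTarget_mul_transpose,
      hreg.dartSource_mul_transpose, Matrix.mul_one]
    module
  | more k ih1 ih2 =>
    rw [hreg.dartSource_mul_nbMatrix_pow_add_two (k + 1)]
    nth_rw 2 [hreg.dartSource_mul_nbMatrix_pow_add_two k]
    rw [hrec (k + 2), Matrix.sub_mul, Matrix.sub_mul, Matrix.smul_mul, Matrix.smul_mul,
      Matrix.mul_assoc (G.adjMatrix ℝ), Matrix.mul_assoc (G.adjMatrix ℝ)]
    rw [sub_eq_iff_eq_add] at ih1 ih2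
    rw [ih1, ih2, Matrix.mul_add, Matrix.mul_sub, hrec k]
    module

theorem IsRegularOfDegree.trace_nbMatrix_pow (hreg : G.IsRegularOfDegree d)
    {s : ℝ} (hs : s ≠ 0) (hsd : s ^ 2 = (d : ℝ) - 1) (k : ℕ) :
    (G.nbMatrix ^ k).trace = (if Even k then (Fintype.card V : ℝ) * ((d : ℝ) - 2) else 0) +
      2 * s ^ k * (Polynomial.aeval ((2 * s)⁻¹ • G.adjMatrix ℝ)
        (Polynomial.Chebyshev.T ℝ (k : ℤ))).trace := by
  induction k using Nat.twoStepInduction with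
  | zero =>
    simp [Matrix.trace_one, G.dart_card_eq_sum_degrees, hreg.degree_eq]
    ring
  | one =>
    rw [pow_one, nbMatrix, Matrix.trace_sub, Matrix.trace_mul_comm,
      dartSource_mul_dartTarget_transpose]
    have : G.dartFlip.trace = 0 :=
      Finset.sum_eq_zero fun e _ => by simp [dartFlip, e.symm_ne]
    simp [this]
  | more k ih _ =>
    rw [trace_nbMatrix_pow_add_two, hreg.nb_sub_eq_scaled_chebyshevT_sub hs hsd, ih,
      Matrix.trace_sub, Matrix.trace_smul, Matrix.trace_smul, smul_eq_mul, smul_eq_mul]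
    simp only [Nat.even_add, even_two, iff_true]
    ring

end SimpleGraph


open Polynomial in
theorem nbCycleCount_eq_chebyshevT (G : SimpleGraph V) [Fintype V] [DecidableEq V]
    [DecidableRel G.Adj] (d : ℕ) (hd : 2 ≤ d) (hreg : G.IsRegularOfDegree d)
    (k : ℕ) (hk : 1 ≤ k) :
    (Odd k →
      (nbCycleCount G k : ℝ) =
        2 * (Real.sqrt ((d : ℝ) - 1)) ^ k *
          Matrix.trace (Polynomial.aeval ((2 * Real.sqrt ((d : ℝ) - 1))⁻¹ • G.adjMatrix ℝ)
            (Polynomial.Chebyshev.T ℝ (k : ℤ)))) ∧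
    (Even k →
      (nbCycleCount G k : ℝ) =
        (Fintype.card V : ℝ) * ((d : ℝ) - 2) +
          2 * (Real.sqrt ((d : ℝ) - 1)) ^ k *
            Matrix.trace (Polynomial.aeval ((2 * Real.sqrt ((d : ℝ) - 1))⁻¹ • G.adjMatrix ℝ)
              (Polynomial.Chebyshev.T ℝ (k : ℤ)))) := by
  have hd' : (0 : ℝ) < (d : ℝ) - 1 := by
    have : (2 : ℝ) ≤ d := by exact_mod_cast hd
    linarith
  rw [G.nbCycleCount_eq_trace_nbMatrix_pow hk,
    hreg.trace_nbMatrix_pow (Real.sqrt_pos.2 hd').ne' (Real.sq_sqrt hd'.le)]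
  exact ⟨fun h => by simp [Nat.not_even_iff_odd.2 h], fun h => by simp [h]⟩
end
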